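/- For all σ, τ ∈ S = {0,+,−,Λ}, the reachable sign set R(σ,τ) := {ρ ∈ S : there exist x, y, z ∈ H with sgn(x) = σ, sgn(y) = τ, z ∈ x⊞y, and sgn(z) = ρ} equals the sign hyper-sum σ ⊛ τ. In particular, every sign in σ⊛τ is realized as the sign of some hyper-sum of elements with signs σ and τ. -/

import Mathlib

inductive Sgn : Type
  | pos | neg | lam
deriving DecidableEq

inductive H : Type
  | zero : H
  | elt (σ : Sgn) (a : ℝ) (ha : 0 < a) : H

noncomputable def hadd : H → H → Set H
  | H.zero, x => {x}
  | x, H.zero => {x}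
  | H.elt Sgn.pos a _, H.elt Sgn.pos b _ =>
      {H.elt Sgn.pos (a + b) (by linarith)}
  | H.elt Sgn.neg a _, H.elt Sgn.neg b _ =>
      {H.elt Sgn.neg (a + b) (by linarith)}
  | H.elt Sgn.pos a _, H.elt Sgn.neg b _ =>
      if h : b < a then {H.elt Sgn.pos (a - b) (by linarith)}
      else if h' : a = b then {H.zero}
      else {H.elt Sgn.neg (b - a)
        (by push_neg at h; exact sub_pos.mpr (lt_of_le_of_ne h h'))}
  | H.elt Sgn.neg b _, H.elt Sgn.pos a _ =>
      if h : b < a then {H.elt Sgn.pos (a - b) (by linarith)}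
      else if h' : a = b then {H.zero}
      else {H.elt Sgn.neg (b - a)
        (by push_neg at h; exact sub_pos.mpr (lt_of_le_of_ne h h'))}
  | H.elt Sgn.pos a _, H.elt Sgn.lam b _ => {H.elt Sgn.lam (a + b) (by linarith)}
  | H.elt Sgn.neg a _, H.elt Sgn.lam b _ => {H.elt Sgn.lam (a + b) (by linarith)}
  | H.elt Sgn.lam b _, H.elt Sgn.pos a _ => {H.elt Sgn.lam (a + b) (by linarith)}
  | H.elt Sgn.lam b _, H.elt Sgn.neg a _ => {H.elt Sgn.lam (a + b) (by linarith)}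
  | H.elt Sgn.lam a _, H.elt Sgn.lam b _ =>
      if h : a = b then {H.elt Sgn.lam (2 * a) (by linarith), H.zero}
      else {H.elt Sgn.lam (a + b) (by linarith),
            H.elt Sgn.pos |a - b| (abs_pos.mpr (sub_ne_zero.mpr h)),
            H.elt Sgn.neg |a - b| (abs_pos.mpr (sub_ne_zero.mpr h))}

/-- Left bracketing `(x ⊞ y) ⊞ z` of the triple hyper-sum. -/
noncomputable def haddL (x y z : H) : Set H := ⋃ u ∈ hadd x y, hadd u z

/-- Right bracketing `x ⊞ (y ⊞ z)` of the triple hyper-sum. -/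
noncomputable def haddR (x y z : H) : Set H := ⋃ v ∈ hadd y z, hadd x v

/-- The four-element sign set `S = {0, +, −, Λ}`. -/
inductive S : Type
  | zero | pos | neg | lam
deriving DecidableEq

/-- The sign map `sgn : H → S`. -/
def sgnH : H → S
  | H.zero => S.zero
  | H.elt Sgn.pos _ _ => S.pos
  | H.elt Sgn.neg _ _ => S.neg
  | H.elt Sgn.lam _ _ => S.lam

/-- The sign hyperoperation `⊛` on `S`. -/
def sop : S → S → Set S
  | S.zero, σ => {σ}
  | σ, S.zero => {σ}
  | S.pos, S.pos => {S.pos}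
  | S.neg, S.neg => {S.neg}
  | S.pos, S.neg => {S.pos, S.zero, S.neg}
  | S.neg, S.pos => {S.pos, S.zero, S.neg}
  | S.pos, S.lam => {S.lam}
  | S.lam, S.pos => {S.lam}
  | S.neg, S.lam => {S.lam}
  | S.lam, S.neg => {S.lam}
  | S.lam, S.lam => {S.zero, S.pos, S.neg, S.lam}

theorem sgnH_mem_sop {x y z : H} (hz : z ∈ hadd x y) : sgnH z ∈ sop (sgnH x) (sgnH y) := by
  rcases x with _ | ⟨_ | _ | _, a, ha⟩ <;> rcases y with _ | ⟨_ | _ | _, b, hb⟩ <;>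
    simp only [hadd] at hz <;> (try split_ifs at hz) <;>
    simp only [Set.mem_insert_iff, Set.mem_singleton_iff] at hz <;>
    rcases hz with rfl | rfl | rfl <;> simp [sgnH, sop]

/-- The hypernumber of sign `σ` and magnitude `a`, where sign zero gives `H.zero`. -/
def S.toH (a : ℝ) (ha : 0 < a) : S → H
  | S.zero => H.zero
  | S.pos => H.elt Sgn.pos a ha
  | S.neg => H.elt Sgn.neg a ha
  | S.lam => H.elt Sgn.lam a ha

theorem sgnH_toH (a : ℝ) (ha : 0 < a) (σ : S) : sgnH (σ.toH a ha) = σ := by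
  cases σ <;> rfl

/-- Magnitudes `1` and `2` already realize every sign in `σ ⊛ τ`. -/
theorem exists_mem_hadd_toH {σ τ ρ : S} (h : ρ ∈ sop σ τ) :
    (∃ z ∈ hadd (σ.toH 1 one_pos) (τ.toH 1 one_pos), sgnH z = ρ) ∨
    (∃ z ∈ hadd (σ.toH 1 one_pos) (τ.toH 2 two_pos), sgnH z = ρ) ∨
    (∃ z ∈ hadd (σ.toH 2 two_pos) (τ.toH 1 one_pos), sgnH z = ρ) := by
  cases σ <;> cases τ <;> cases ρ <;> simp [sop] at h <;> simp [S.toH, hadd, sgnH]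

theorem stmt_12 (σ τ : S) :
    {ρ : S | ∃ x y z : H, sgnH x = σ ∧ sgnH y = τ ∧ z ∈ hadd x y ∧ sgnH z = ρ}
      = sop σ τ := by
  ext ρ
  constructor
  · rintro ⟨x, y, z, rfl, rfl, hz, rfl⟩
    exact sgnH_mem_sop hz
  · intro h
    rcases exists_mem_hadd_toH h with ⟨z, hz, hρ⟩ | ⟨z, hz, hρ⟩ | ⟨z, hz, hρ⟩ <;>
      exact ⟨_, _, z, sgnH_toH _ _ σ, sgnH_toH _ _ τ, hz, hρ⟩
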